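/- For Lebesgue-almost every x ∈ (0,1), the Fibonacci exponent of x exists and equals (Σ_{n=1}^∞ ℓ_n λ^{−2n−1})/(4λ+3): lim_{n→∞} (1/n)·log_λ f(ε_1(x),…,ε_n(x)) = (Σ_{n=1}^∞ ℓ_n λ^{−2n−1})/(4λ+3), where ℓ_n = Σ_{t≥1} Σ_{(a_1,…,a_t) ∈ ℤ_{>0}^t, a_1+⋯+a_t = n} log_λ(p+q), with p/q = [a_1,…,a_t] in lowest terms. -/

import Mathlib

/-- The golden ratio λ = (1+√5)/2. -/
noncomputable def gold : ℝ := (1 + Real.sqrt 5) / 2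

/-- The value Σ_{j=1}^ℓ w_j λ^{-j} of a 0-1 word `(w_1, …, w_ℓ)`. -/
noncomputable def wordVal : List Bool → ℝ
  | [] => 0
  | b :: t => ((if b then 1 else 0) + wordVal t) / gold

/-- `wordF w` is the number of 0-1 words of the same length as `w` having the same
value as `w`. -/
noncomputable def wordF (w : List Bool) : ℕ :=
  Nat.card {v : List Bool // v.length = w.length ∧ wordVal v = wordVal w}

/-- The block `B(a_1, …, a_t)`: the 0-1 word `1(00)^{a_1}(01)^{a_2}⋯(00)^{a_t}` if `t`
is odd and `1(01)^{a_1}(00)^{a_2}⋯(00)^{a_t}` if `t` is even (`1 = true`, `0 = false`);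
the `i`-th group is `(00)^{a_i}` when `i ≡ t (mod 2)` and `(01)^{a_i}` otherwise. -/
def blockWord (a : List ℕ) : List Bool :=
  true :: (((List.range a.length).map fun i =>
    (List.replicate (a.getD i 0)
      (if (a.length - 1 - i) % 2 = 0 then [false, false] else [false, true])).flatten).flatten)

/-- The finite continued fraction `[a_1, …, a_t] = 1/(a_1 + 1/(a_2 + ⋯ + 1/a_t))`. -/
def cf : List ℕ → ℚ
  | [] => 0
  | a :: t => 1 / ((a : ℚ) + cf t)

/-- `p + q` where `p/q = [a_1, …, a_t]` in lowest terms. -/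
def pqSum (a : List ℕ) : ℕ := (cf a).num.toNat + (cf a).den


open MeasureTheory Filter Topology

/-- The map `T x = {λ x}`. -/
noncomputable def Tgold (x : ℝ) : ℝ := Int.fract (gold * x)

/-- The digits of the canonical (greedy) expansion: `digit k x = ⌊λ Tᵏ x⌋` is the
`(k+1)`-st digit `ε_{k+1}(x)`. -/
noncomputable def digit (k : ℕ) (x : ℝ) : ℤ := ⌊gold * Tgold^[k] x⌋

/-- The word of the first `n` digits `(ε_1(x), …, ε_n(x))` of the canonical expansion. -/
noncomputable def digitWord (n : ℕ) (x : ℝ) : List Bool :=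
  (List.range n).map fun j => decide (digit j x = 1)

/-- `ℓ_n = Σ over compositions (a_1,…,a_t) of n of log_λ(p+q)`, where
`p/q = [a_1,…,a_t]` in lowest terms. -/
noncomputable def ellcoef (n : ℕ) : ℝ :=
  ∑' a : {l : List ℕ // l.sum = n ∧ ∀ x ∈ l, 0 < x}, Real.logb gold (pqSum a.1)

lemma gold_sq : gold ^ 2 = gold + 1 := Real.goldenRatio_sq

lemma one_lt_gold : 1 < gold := Real.one_lt_goldenRatio

lemma gold_lt_two : gold < 2 := Real.goldenRatio_lt_two

lemma gold_pos : 0 < gold := zero_lt_one.trans one_lt_gold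

lemma gold_inv : gold⁻¹ = gold - 1 := by
  have := gold_pos
  field_simp
  linarith [gold_sq]

/-- The number of 0-1 words of length `n` whose value is `x`. -/
noncomputable def repCount (n : ℕ) (x : ℝ) : ℕ :=
  Nat.card {v : List Bool // v.length = n ∧ wordVal v = x}

lemma wordF_eq_repCount (w : List Bool) : wordF w = repCount w.length (wordVal w) := rfl

lemma finite_words (n : ℕ) (P : List Bool → Prop) :
    Finite {v : List Bool // v.length = n ∧ P v} :=
  Set.Finite.subset (List.finite_length_eq Bool n) fun _ h => h.1

lemma repCount_zero (x : ℝ) : repCount 0 x = if x = 0 then 1 else 0 := by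
  unfold repCount
  split_ifs with h
  · rw [Nat.card_eq_one_iff_unique]
    refine ⟨⟨fun a b => ?_⟩, ⟨⟨[], rfl, h.symm⟩⟩⟩
    have ha := List.length_eq_zero_iff.1 a.2.1
    have hb := List.length_eq_zero_iff.1 b.2.1
    exact Subtype.ext (ha.trans hb.symm)
  · rw [Nat.card_eq_zero]
    left
    refine ⟨fun a => h ?_⟩
    have := a.2.2
    rw [List.length_eq_zero_iff.1 a.2.1] at this
    exact this.symm

lemma wordVal_false_cons (t : List Bool) (x : ℝ) :
    wordVal (false :: t) = x ↔ wordVal t = gold * x := by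
  have := gold_pos
  simp only [wordVal, Bool.false_eq_true, if_false, zero_add]
  rw [div_eq_iff this.ne', mul_comm]

lemma wordVal_true_cons (t : List Bool) (x : ℝ) :
    wordVal (true :: t) = x ↔ wordVal t = gold * x - 1 := by
  have := gold_pos
  simp only [wordVal, if_true]
  rw [div_eq_iff this.ne', mul_comm, eq_sub_iff_add_eq, add_comm]

lemma repCount_succ (n : ℕ) (x : ℝ) :
    repCount (n + 1) x = repCount n (gold * x) + repCount n (gold * x - 1) := by
  have := finite_words n fun v => wordVal v = gold * x
  have := finite_words n fun v => wordVal v = gold * x - 1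
  unfold repCount
  rw [← Nat.card_sum]
  symm
  refine Nat.card_congr (Equiv.ofBijective (Sum.elim
    (fun v => ⟨false :: v.1, by simp [v.2.1], (wordVal_false_cons _ _).2 v.2.2⟩)
    (fun v => ⟨true :: v.1, by simp [v.2.1], (wordVal_true_cons _ _).2 v.2.2⟩)) ⟨?_, ?_⟩)
  · rintro (⟨a, ha⟩ | ⟨a, ha⟩) (⟨b, hb⟩ | ⟨b, hb⟩) h <;> simp_all
  · rintro ⟨_ | ⟨_ | _, t⟩, hl, hv⟩
    · simp at hl
    · exact ⟨.inl ⟨t, by simpa using hl, (wordVal_false_cons _ _).1 hv⟩, rfl⟩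
    · exact ⟨.inr ⟨t, by simpa using hl, (wordVal_true_cons _ _).1 hv⟩, rfl⟩

lemma repCount_eq_zero_of_neg (n : ℕ) : ∀ x < 0, repCount n x = 0 := by
  have := gold_pos
  induction n with
  | zero => exact fun x hx => by simp [repCount_zero, hx.ne]
  | succ n ih =>
    intro x hx
    have : gold * x < 0 := mul_neg_of_pos_of_neg this hx
    rw [repCount_succ, ih _ this, ih _ (by linarith)]

lemma repCount_eq_zero_of_ge (n : ℕ) : ∀ x ≥ gold, repCount n x = 0 := by
  have := gold_pos
  induction n with
  | zero => exact fun x hx => by simp [repCount_zero, (this.trans_le hx).ne']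
  | succ n ih =>
    intro x hx
    have h : gold + 1 ≤ gold * x := by nlinarith [gold_sq]
    rw [repCount_succ, ih _ (by linarith), ih _ (by linarith)]

lemma Tgold_of_lt {x : ℝ} (h0 : 0 ≤ x) (h1 : gold * x < 1) : Tgold x = gold * x :=
  Int.fract_eq_self.2 ⟨mul_nonneg gold_pos.le h0, h1⟩

lemma Tgold_of_ge {x : ℝ} (h0 : 1 ≤ gold * x) (h1 : x < 1) : Tgold x = gold * x - 1 := by
  have : ⌊gold * x⌋ = 1 := by
    rw [Int.floor_eq_iff]
    have := one_lt_gold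
    have := gold_lt_two
    push_cast
    constructor <;> nlinarith
  rw [Tgold, Int.fract, this, Int.cast_one]

lemma digitWord_succ (n : ℕ) (x : ℝ) :
    digitWord (n + 1) x = decide (digit 0 x = 1) :: digitWord n (Tgold x) := by
  simp only [digitWord, List.range_succ_eq_map, List.map_cons, List.map_map]
  rfl

lemma digitWord_succ_of_lt {x : ℝ} (n : ℕ) (h0 : 0 ≤ x) (h1 : gold * x < 1) :
    digitWord (n + 1) x = false :: digitWord n (gold * x) := by
  rw [digitWord_succ, Tgold_of_lt h0 h1]
  have : ⌊gold * x⌋ = 0 := Int.floor_eq_zero_iff.2 ⟨mul_nonneg gold_pos.le h0, h1⟩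
  simp [digit, this]

lemma digitWord_succ_of_ge {x : ℝ} (n : ℕ) (h0 : 1 ≤ gold * x) (h1 : x < 1) :
    digitWord (n + 1) x = true :: digitWord n (gold * x - 1) := by
  rw [digitWord_succ, Tgold_of_ge h0 h1]
  have : ⌊gold * x⌋ = 1 := by
    have h := Tgold_of_ge h0 h1
    rw [Tgold, Int.fract] at h
    exact_mod_cast (by linarith : (⌊gold * x⌋ : ℝ) = 1)
  simp [digit, this]

lemma length_digitWord (n : ℕ) (x : ℝ) : (digitWord n x).length = n := by
  simp [digitWord]

/-- The value of the first `n` digits of `x`. -/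
noncomputable def truncVal (n : ℕ) (x : ℝ) : ℝ := wordVal (digitWord n x)

lemma truncVal_zero (x : ℝ) : truncVal 0 x = 0 := rfl

lemma gold_mul_truncVal_of_lt {x : ℝ} (n : ℕ) (h0 : 0 ≤ x) (h1 : gold * x < 1) :
    gold * truncVal (n + 1) x = truncVal n (gold * x) := by
  rw [truncVal, digitWord_succ_of_lt n h0 h1]
  exact ((wordVal_false_cons _ _).1 rfl).symm

lemma gold_mul_truncVal_of_ge {x : ℝ} (n : ℕ) (h0 : 1 ≤ gold * x) (h1 : x < 1) :
    gold * truncVal (n + 1) x = truncVal n (gold * x - 1) + 1 := by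
  rw [truncVal, digitWord_succ_of_ge n h0 h1]
  exact (sub_eq_iff_eq_add.1 ((wordVal_true_cons _ _).1 rfl).symm)

lemma truncVal_nonneg (n : ℕ) (x : ℝ) : 0 ≤ truncVal n x := by
  have h : ∀ w : List Bool, 0 ≤ wordVal w := by
    intro w
    induction w with
    | nil => exact le_rfl
    | cons b t ih =>
      have := gold_pos
      unfold wordVal
      positivity
  exact h _

lemma gold_mul_sub_one_mem {x : ℝ} (h0 : 1 ≤ gold * x) (h1 : x < 1) :
    gold * x - 1 ∈ Set.Ico 0 1 :=
  ⟨by linarith, by nlinarith [gold_lt_two, gold_pos]⟩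

lemma truncVal_le (n : ℕ) : ∀ x ∈ Set.Ico (0 : ℝ) 1, truncVal n x ≤ x := by
  have hg := gold_pos
  induction n with
  | zero => exact fun x hx => hx.1
  | succ n ih =>
    intro x hx
    rcases lt_or_ge (gold * x) 1 with h | h
    · have := ih (gold * x) ⟨mul_nonneg hg.le hx.1, h⟩
      rw [← gold_mul_truncVal_of_lt n hx.1 h] at this
      exact le_of_mul_le_mul_left this hg
    · have := ih _ (gold_mul_sub_one_mem h hx.2)
      refine le_of_mul_le_mul_left (a := gold) ?_ hg
      rw [gold_mul_truncVal_of_ge n h hx.2]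
      linarith

/-- The number of words of length `n` whose value is `c` plus that of the first `n` digits
of `x`. -/
noncomputable def shiftCount (c : ℝ) (n : ℕ) (x : ℝ) : ℕ := repCount n (truncVal n x + c)

lemma wordF_digitWord (n : ℕ) (x : ℝ) : wordF (digitWord n x) = shiftCount 0 n x := by
  rw [wordF_eq_repCount, length_digitWord, shiftCount, add_zero, truncVal]

section Recursion

variable {x : ℝ} (n : ℕ)

lemma shiftCount_zero_of_lt (h0 : 0 ≤ x) (h1 : gold * x < 1) :
    shiftCount 0 (n + 1) x = shiftCount 0 n (gold * x) := by
  have := truncVal_le n (gold * x) ⟨mul_nonneg gold_pos.le h0, h1⟩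
  rw [shiftCount, shiftCount, repCount_succ, add_zero, add_zero,
    gold_mul_truncVal_of_lt n h0 h1,
    repCount_eq_zero_of_neg n (truncVal n (gold * x) - 1) (by linarith), add_zero]

lemma shiftCount_one_of_lt (h0 : 0 ≤ x) (h1 : gold * x < 1) :
    shiftCount 1 (n + 1) x = shiftCount gold⁻¹ n (gold * x) := by
  have := truncVal_nonneg n (gold * x)
  rw [shiftCount, shiftCount, repCount_succ, mul_add, mul_one,
    gold_mul_truncVal_of_lt n h0 h1, repCount_eq_zero_of_ge n _ (by linarith), zero_add,
    gold_inv, add_sub_assoc]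

lemma shiftCount_inv_of_lt (h0 : 0 ≤ x) (h1 : gold * x < 1) :
    shiftCount gold⁻¹ (n + 1) x = shiftCount 1 n (gold * x) + shiftCount 0 n (gold * x) := by
  rw [shiftCount, shiftCount, shiftCount, repCount_succ, mul_add,
    gold_mul_truncVal_of_lt n h0 h1, mul_inv_cancel₀ gold_pos.ne', add_sub_cancel_right, add_zero]

lemma shiftCount_zero_of_ge (h0 : 1 ≤ gold * x) (h1 : x < 1) :
    shiftCount 0 (n + 1) x =
      shiftCount 1 n (gold * x - 1) + shiftCount 0 n (gold * x - 1) := by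
  rw [shiftCount, shiftCount, shiftCount, repCount_succ, mul_add,
    gold_mul_truncVal_of_ge n h0 h1, mul_zero, add_zero, add_sub_cancel_right, add_zero]

lemma shiftCount_one_of_ge (h0 : 1 ≤ gold * x) (h1 : x < 1) :
    shiftCount 1 n x = 0 := by
  cases n with
  | zero => simp [shiftCount, truncVal_zero, repCount_zero]
  | succ n =>
    have := truncVal_nonneg n (gold * x - 1)
    rw [shiftCount, repCount_succ, mul_add, gold_mul_truncVal_of_ge n h0 h1,
      repCount_eq_zero_of_ge n _ (by linarith), repCount_eq_zero_of_ge n _ (by linarith)]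

lemma shiftCount_inv_of_ge (h0 : 1 ≤ gold * x) (h1 : x < 1) :
    shiftCount gold⁻¹ (n + 1) x = shiftCount 1 n (gold * x - 1) := by
  have := truncVal_nonneg n (gold * x - 1)
  have := gold_lt_two
  rw [shiftCount, shiftCount, repCount_succ, mul_add, gold_mul_truncVal_of_ge n h0 h1,
    mul_inv_cancel₀ gold_pos.ne', repCount_eq_zero_of_ge n _ (by linarith), zero_add,
    add_sub_cancel_right]

end Recursion

lemma shiftCount_le_succ (n : ℕ) : ∀ x ∈ Set.Ico (0 : ℝ) 1,
    shiftCount 0 n x ≤ shiftCount 0 (n + 1) x ∧ shiftCount 1 n x ≤ shiftCount 1 (n + 1) x ∧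
      shiftCount gold⁻¹ n x ≤ shiftCount gold⁻¹ (n + 1) x := by
  have hg := gold_pos
  induction n with
  | zero =>
    intro x hx
    have h1 : shiftCount 1 0 x = 0 := by simp [shiftCount, truncVal_zero, repCount_zero]
    have h2 : shiftCount gold⁻¹ 0 x = 0 := by
      simp [shiftCount, truncVal_zero, repCount_zero, hg.ne']
    have h3 : ∀ y, shiftCount 0 0 y = 1 := by simp [shiftCount, truncVal_zero, repCount_zero]
    rw [h1, h2]
    refine ⟨?_, Nat.zero_le _, Nat.zero_le _⟩
    rcases lt_or_ge (gold * x) 1 with h | h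
    · rw [shiftCount_zero_of_lt 0 hx.1 h, h3, h3]
    · rw [shiftCount_zero_of_ge 0 h hx.2, h3, h3]
      omega
  | succ n ih =>
    intro x hx
    rcases lt_or_ge (gold * x) 1 with h | h
    · have := ih (gold * x) ⟨mul_nonneg hg.le hx.1, h⟩
      simp only [shiftCount_zero_of_lt _ hx.1 h, shiftCount_one_of_lt _ hx.1 h,
        shiftCount_inv_of_lt _ hx.1 h]
      omega
    · have := ih _ (gold_mul_sub_one_mem h hx.2)
      simp only [shiftCount_zero_of_ge _ h hx.2, shiftCount_one_of_ge _ h hx.2,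
        shiftCount_inv_of_ge _ h hx.2]
      omega

lemma monotone_shiftCount {x : ℝ} (hx : x ∈ Set.Ico (0 : ℝ) 1) :
    Monotone fun n => shiftCount 0 n x :=
  monotone_nat_of_le_succ fun n => (shiftCount_le_succ n x hx).1

lemma shiftCount_zero_zero (x : ℝ) : shiftCount 0 0 x = 1 := by
  simp [shiftCount, truncVal_zero, repCount_zero]

lemma one_le_shiftCount {x : ℝ} (hx : x ∈ Set.Ico (0 : ℝ) 1) (n : ℕ) :
    1 ≤ shiftCount 0 n x :=
  (shiftCount_zero_zero x).ge.trans (monotone_shiftCount hx n.zero_le)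

/-- The points of `[0, 1)` whose first digit is `1`. -/
noncomputable def topInterval : Set ℝ := Set.Ico gold⁻¹ 1

lemma mem_topInterval {x : ℝ} : x ∈ topInterval ↔ 1 ≤ gold * x ∧ x < 1 := by
  rw [topInterval, Set.mem_Ico, inv_le_iff_one_le_mul₀' gold_pos]

lemma topInterval_subset : topInterval ⊆ Set.Ico 0 1 :=
  Set.Ico_subset_Ico_left (inv_nonneg.2 gold_pos.le)

/-- A list `s` of booleans encodes the block consisting of `1`, then the pairs `00` (for
`false`) and `01` (for `true`), then a final pair `00`. -/
def blockLen (s : List Bool) : ℕ := 2 * s.length + 3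

/-- The numbers of words of the same length as the pairs of the block `s` whose value exceeds
theirs by `0`, respectively by `1`. -/
def pairVec : List Bool → ℕ × ℕ
  | [] => (1, 1)
  | false :: s => ((pairVec s).1, (pairVec s).2 + (pairVec s).1)
  | true :: s => ((pairVec s).2 + (pairVec s).1, (pairVec s).2)

/-- The number of words of the same length and value as the block `s`. -/
def blockCount (s : List Bool) : ℕ := (pairVec s).2 + (pairVec s).1

/-- The affine branch of an iterate of `Tgold` deleting the pairs of the block `s`. -/
noncomputable def pairMap : List Bool → ℝ → ℝ
  | [], y => gold * (gold * y)
  | false :: s, y => pairMap s (gold * (gold * y))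
  | true :: s, y => pairMap s (gold * (gold * y) - 1)

/-- The affine branch of an iterate of `Tgold` deleting the block `s`. -/
noncomputable def blockMap (s : List Bool) (x : ℝ) : ℝ := pairMap s (gold * x - 1)

lemma bounds_of_pairMap_mem (s : List Bool) :
    ∀ y, pairMap s y ∈ topInterval → 0 ≤ y ∧ gold * y < 1 := by
  have hg := one_lt_gold
  have hs := gold_sq
  have key : ∀ y, gold * (gold * y) < 1 → 0 ≤ gold * (gold * y) → 0 ≤ y ∧ gold * y < 1 := by
    intro y h1 h0
    have h0' : 0 ≤ gold * y := nonneg_of_mul_nonneg_right h0 gold_pos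
    exact ⟨nonneg_of_mul_nonneg_right h0' gold_pos, by nlinarith⟩
  induction s with
  | nil => exact fun y h => key y h.2 (topInterval_subset h).1
  | cons b s ih =>
    intro y h
    cases b with
    | false =>
      have := ih _ h
      exact key y (by nlinarith) this.1
    | true =>
      obtain ⟨h0, h1⟩ := ih _ h
      have h0' : 0 ≤ gold * y := by
        refine nonneg_of_mul_nonneg_right (a := gold) ?_ gold_pos
        linarith
      refine ⟨nonneg_of_mul_nonneg_right h0' gold_pos, ?_⟩
      nlinarith

lemma eq_of_pairMap_mem (s : List Bool) : ∀ s' y, pairMap s y ∈ topInterval →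
    pairMap s' y ∈ topInterval → s = s' := by
  induction s with
  | nil =>
    rintro (_ | ⟨_ | _, s'⟩) y h h'
    · rfl
    · have h1 := (mem_topInterval.1 h).1
      have h2 := (bounds_of_pairMap_mem s' _ h').2
      simp only [pairMap] at h1 h2
      linarith
    · have h1 := h.2
      have h2 := (bounds_of_pairMap_mem s' _ h').1
      simp only [pairMap] at h1 h2
      linarith
  | cons b s ih =>
    rintro (_ | ⟨b', s'⟩) y h h'
    · cases b with
      | false =>
        have h1 := (mem_topInterval.1 h').1
        have h2 := (bounds_of_pairMap_mem s _ h).2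
        simp only [pairMap] at h1 h2
        linarith
      | true =>
        have h1 := h'.2
        have h2 := (bounds_of_pairMap_mem s _ h).1
        simp only [pairMap] at h1 h2
        linarith
    · have hs := bounds_of_pairMap_mem s
      have hs' := bounds_of_pairMap_mem s'
      have hg := one_lt_gold
      cases b <;> cases b' <;> simp only [pairMap] at h h'
      · rw [ih _ _ h h']
      · have h1 := hs _ h
        have h2 := hs' _ h'
        nlinarith
      · have h1 := hs _ h
        have h2 := hs' _ h'
        nlinarith
      · rw [ih _ _ h h']

lemma eq_of_blockMap_mem {s s' : List Bool} {x : ℝ} (h : blockMap s x ∈ topInterval)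
    (h' : blockMap s' x ∈ topInterval) : s = s' :=
  eq_of_pairMap_mem s s' _ h h'

lemma mem_topInterval_of_blockMap_mem {s : List Bool} {x : ℝ}
    (h : blockMap s x ∈ topInterval) : x ∈ topInterval := by
  have := bounds_of_pairMap_mem s _ h
  have hg := one_lt_gold
  rw [mem_topInterval]
  refine ⟨by linarith [this.1], ?_⟩
  nlinarith [this.2, gold_sq]

lemma shiftCount_pairMap (n : ℕ) (s : List Bool) : ∀ y, pairMap s y ∈ topInterval →
    shiftCount 0 (n + 2 * s.length + 2) y = (pairVec s).1 * shiftCount 0 n (pairMap s y) ∧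
    shiftCount 1 (n + 2 * s.length + 2) y = (pairVec s).2 * shiftCount 0 n (pairMap s y) := by
  have hg := one_lt_gold
  induction s with
  | nil =>
    intro y h
    obtain ⟨h0, h1⟩ := bounds_of_pairMap_mem _ y h
    have hz := mem_topInterval.1 h
    simp only [pairMap] at h hz
    have h0' : 0 ≤ gold * y := mul_nonneg gold_pos.le h0
    simp only [List.length_nil, mul_zero, add_zero, pairVec, pairMap, one_mul]
    rw [shiftCount_zero_of_lt _ h0 h1, shiftCount_zero_of_lt _ h0' hz.2,
      shiftCount_one_of_lt _ h0 h1, shiftCount_inv_of_lt _ h0' hz.2,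
      shiftCount_one_of_ge n hz.1 hz.2, zero_add]
    exact ⟨rfl, rfl⟩
  | cons b s ih =>
    intro y h
    obtain ⟨h0, h1⟩ := bounds_of_pairMap_mem _ y h
    have h0' : 0 ≤ gold * y := mul_nonneg gold_pos.le h0
    have hl : n + 2 * (b :: s).length + 2 = n + 2 * s.length + 2 + 1 + 1 := by
      simp only [List.length_cons]
      ring
    rw [hl]
    cases b with
    | false =>
      obtain ⟨ih1, ih2⟩ := ih _ h
      have h1' : gold * (gold * y) < 1 := by
        have := bounds_of_pairMap_mem s _ h
        nlinarith
      rw [shiftCount_zero_of_lt _ h0 h1, shiftCount_zero_of_lt _ h0' h1',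
        shiftCount_one_of_lt _ h0 h1, shiftCount_inv_of_lt _ h0' h1', ih1, ih2]
      exact ⟨rfl, (add_mul _ _ _).symm⟩
    | true =>
      obtain ⟨ih1, ih2⟩ := ih _ h
      have h1' : 1 ≤ gold * (gold * y) := by linarith [(bounds_of_pairMap_mem s _ h).1]
      rw [shiftCount_zero_of_lt _ h0 h1, shiftCount_zero_of_ge _ h1' h1,
        shiftCount_one_of_lt _ h0 h1, shiftCount_inv_of_ge _ h1' h1, ih1, ih2]
      exact ⟨(add_mul _ _ _).symm, rfl⟩

lemma shiftCount_blockMap (n : ℕ) {s : List Bool} {x : ℝ} (h : blockMap s x ∈ topInterval) :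
    shiftCount 0 (n + blockLen s) x = blockCount s * shiftCount 0 n (blockMap s x) := by
  have hx := mem_topInterval.1 (mem_topInterval_of_blockMap_mem h)
  obtain ⟨h1, h2⟩ := shiftCount_pairMap n s _ h
  rw [show n + blockLen s = n + 2 * s.length + 2 + 1 by unfold blockLen; ring,
    shiftCount_zero_of_ge _ hx.1 hx.2, h1, h2, blockCount, add_mul]
  rfl

lemma pairMap_affine (s : List Bool) :
    ∃ c, ∀ y, pairMap s y = gold ^ (2 * s.length + 2) * y + c := by
  induction s with
  | nil => exact ⟨0, fun y => by simp only [pairMap, List.length_nil]; ring⟩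
  | cons b s ih =>
    obtain ⟨c, hc⟩ := ih
    cases b with
    | false => exact ⟨c, fun y => by simp only [pairMap, hc, List.length_cons]; ring⟩
    | true =>
      exact ⟨c - gold ^ (2 * s.length + 2), fun y => by
        simp only [pairMap, hc, List.length_cons]; ring⟩

lemma blockMap_affine (s : List Bool) : ∃ c, ∀ x, blockMap s x = gold ^ blockLen s * x + c := by
  obtain ⟨c, hc⟩ := pairMap_affine s
  exact ⟨c - gold ^ (2 * s.length + 2), fun x => by simp only [blockMap, hc, blockLen]; ring⟩

lemma measurable_blockMap (s : List Bool) : Measurable (blockMap s) := by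
  obtain ⟨c, hc⟩ := blockMap_affine s
  rw [funext hc]
  fun_prop

/-- The probability of the block `s`. -/
noncomputable def blockProb (s : List Bool) : ℝ := gold⁻¹ ^ blockLen s

lemma blockProb_nonneg (s : List Bool) : 0 ≤ blockProb s :=
  pow_nonneg (inv_nonneg.2 gold_pos.le) _

lemma volume_preimage_blockMap (s : List Bool) (A : Set ℝ) :
    volume (blockMap s ⁻¹' A) = ENNReal.ofReal (blockProb s) * volume A := by
  obtain ⟨c, hc⟩ := blockMap_affine s
  have : blockMap s ⁻¹' A = (fun x => gold ^ blockLen s * x) ⁻¹' ((fun x => x + c) ⁻¹' A) := by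
    ext x
    simp [hc]
  have hp : 0 < gold ^ blockLen s := pow_pos gold_pos _
  rw [this, Real.volume_preimage_mul_left hp.ne', measure_preimage_add_right,
    abs_of_pos (inv_pos.2 hp), blockProb, inv_pow]

/-- Increase the first entry of a list by one. -/
def bumpHead : List ℕ → List ℕ
  | [] => []
  | a :: t => (a + 1) :: t

/-- The lengths of the maximal runs of equal pairs in the block `s`. -/
def runLengths : List Bool → List ℕ
  | [] => [1]
  | b :: s => if b = s.headD false then bumpHead (runLengths s) else 1 :: runLengths s

lemma runLengths_ne_nil (s : List Bool) : runLengths s ≠ [] := by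
  induction s with
  | nil => simp [runLengths]
  | cons b s ih =>
    obtain ⟨a, t, h⟩ := List.exists_cons_of_ne_nil ih
    unfold runLengths
    split_ifs <;> simp [h, bumpHead]

lemma sum_runLengths (s : List Bool) : (runLengths s).sum = s.length + 1 := by
  induction s with
  | nil => simp [runLengths]
  | cons b s ih =>
    obtain ⟨a, t, h⟩ := List.exists_cons_of_ne_nil (runLengths_ne_nil s)
    unfold runLengths
    rw [h] at ih ⊢
    split_ifs <;> simp [bumpHead] at ih ⊢ <;> omega

lemma runLengths_pos (s : List Bool) : ∀ a ∈ runLengths s, 0 < a := by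
  induction s with
  | nil => simp [runLengths]
  | cons b s ih =>
    obtain ⟨a, t, h⟩ := List.exists_cons_of_ne_nil (runLengths_ne_nil s)
    unfold runLengths
    rw [h] at ih ⊢
    split_ifs <;> simp_all [bumpHead]

lemma runLengths_injective : Function.Injective runLengths := by
  intro s
  induction s with
  | nil =>
    intro s' h
    have := congrArg List.sum h
    rw [sum_runLengths, sum_runLengths] at this
    exact (List.length_eq_zero_iff.1 (by simpa using this.symm)).symm
  | cons b s ih =>
    rintro (_ | ⟨b', s'⟩) h
    · have := congrArg List.sum h
      rw [sum_runLengths, sum_runLengths] at this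
      simp at this
    · obtain ⟨a, t, hs⟩ := List.exists_cons_of_ne_nil (runLengths_ne_nil s)
      obtain ⟨a', t', hs'⟩ := List.exists_cons_of_ne_nil (runLengths_ne_nil s')
      have ha : 0 < a := runLengths_pos s a (by simp [hs])
      have ha' : 0 < a' := runLengths_pos s' a' (by simp [hs'])
      have key : runLengths s = runLengths s' ∧
          (b = s.headD false ↔ b' = s'.headD false) := by
        simp only [runLengths, hs, hs', bumpHead] at h ⊢
        split_ifs at h with h1 h2 h2
        · simp_all
        · simp at h
          omega
        · simp at h
          omega
        · simp_all
      obtain rfl := ih key.1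
      have := key.2
      congr 1
      cases b <;> cases b' <;> simp_all

lemma exists_runLengths_eq (n : ℕ) : ∀ l : List ℕ, l.sum = n + 1 → (∀ a ∈ l, 0 < a) →
    ∃ s, runLengths s = l := by
  induction n with
  | zero =>
    rintro (_ | ⟨a, t⟩) hs hp
    · simp at hs
    · have ha := hp a (by simp)
      have ht : t = [] := by
        rcases t with _ | ⟨b, t⟩
        · rfl
        · have := hp b (by simp)
          simp at hs
          omega
      subst ht
      exact ⟨[], by simp at hs; simp [runLengths, hs]⟩
  | succ n ih =>
    rintro (_ | ⟨a, t⟩) hs hp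
    · simp at hs
    · obtain _ | _ | a := a
      · simp at hp
      · obtain ⟨s, rfl⟩ := ih t (by simp at hs; omega) fun x hx => hp x (by simp [hx])
        exact ⟨(!s.headD false) :: s, by simp [runLengths]⟩
      · obtain ⟨s, h⟩ := ih ((a + 1) :: t) (by simp at hs ⊢; omega) (by simp_all)
        exact ⟨s.headD false :: s, by simp [runLengths, h, bumpHead]⟩

lemma cf_bumpHead {l : List ℕ} (hl : l ≠ []) : cf (bumpHead l) = 1 / (1 / cf l + 1) := by
  obtain ⟨a, t, rfl⟩ := List.exists_cons_of_ne_nil hl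
  simp only [bumpHead, cf, one_div_one_div]
  push_cast
  ring

lemma pairVec_pos (s : List Bool) : 0 < (pairVec s).1 ∧ 0 < (pairVec s).2 := by
  induction s with
  | nil => simp [pairVec]
  | cons b s ih => cases b <;> simp only [pairVec] <;> omega

lemma coprime_pairVec (s : List Bool) : (pairVec s).1.Coprime (pairVec s).2 := by
  induction s with
  | nil => simp [pairVec]
  | cons b s ih => cases b <;> simpa [pairVec] using ih

lemma cf_runLengths (s : List Bool) : cf (runLengths s) =
    if s.headD false then ((pairVec s).2 : ℚ) / (pairVec s).1
      else ((pairVec s).1 : ℚ) / (pairVec s).2 := by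
  induction s with
  | nil => simp [runLengths, cf, pairVec]
  | cons b s ih =>
    have h1 : (0 : ℚ) < (pairVec s).1 := by exact_mod_cast (pairVec_pos s).1
    have h2 : (0 : ℚ) < (pairVec s).2 := by exact_mod_cast (pairVec_pos s).2
    unfold runLengths
    by_cases hb : b = s.headD false
    · rw [if_pos hb, cf_bumpHead (runLengths_ne_nil s), ih]
      cases b
      · rw [← hb]
        simp [pairVec]
        field_simp
      · rw [← hb]
        simp [pairVec]
        field_simp
        ring
    · rw [if_neg hb]
      simp only [cf]
      rw [ih]
      cases b
      · rw [show s.headD false = true by simpa using Ne.symm hb]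
        simp [pairVec]
        field_simp
        ring
      · rw [show s.headD false = false by simpa using Ne.symm hb]
        simp [pairVec]
        field_simp

lemma num_add_den_div {p q : ℕ} (hq : 0 < q) (h : p.Coprime q) :
    ((p : ℚ) / q).num.toNat + ((p : ℚ) / q).den = p + q := by
  have h1 := Rat.num_div_eq_of_coprime (a := p) (b := q) (by exact_mod_cast hq) (by simpa using h)
  have h2 := Rat.den_div_eq_of_coprime (a := p) (b := q) (by exact_mod_cast hq) (by simpa using h)
  push_cast at h1 h2
  rw [h1]
  have : ((p : ℚ) / q).den = q := by exact_mod_cast h2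
  rw [this, Int.toNat_natCast]

lemma pqSum_runLengths (s : List Bool) : pqSum (runLengths s) = blockCount s := by
  unfold pqSum
  rw [cf_runLengths, blockCount]
  split_ifs
  · exact num_add_den_div (pairVec_pos s).1 (coprime_pairVec s).symm
  · rw [num_add_den_div (pairVec_pos s).2 (coprime_pairVec s), add_comm]

lemma ellcoef_succ (n : ℕ) : ellcoef (n + 1) =
    ∑' s : {s : List Bool // s.length = n}, Real.logb gold (blockCount s.1) := by
  unfold ellcoef
  let φ : {s : List Bool // s.length = n} → {l : List ℕ // l.sum = n + 1 ∧ ∀ x ∈ l, 0 < x} :=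
    fun s => ⟨runLengths s.1, by rw [sum_runLengths, s.2], runLengths_pos s.1⟩
  have hφ : Function.Bijective φ := by
    constructor
    · intro s s' h
      exact Subtype.ext (runLengths_injective (congrArg Subtype.val h))
    · rintro ⟨l, hs, hp⟩
      obtain ⟨s, rfl⟩ := exists_runLengths_eq n l hs hp
      exact ⟨⟨s, by simpa [sum_runLengths] using hs⟩, rfl⟩
  rw [← (Equiv.ofBijective φ hφ).tsum_eq]
  simp [φ, pqSum_runLengths]

instance (n : ℕ) : Fintype {s : List Bool // s.length = n} :=
  inferInstanceAs (Fintype (List.Vector Bool n))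

lemma card_lists (n : ℕ) : Fintype.card {s : List Bool // s.length = n} = 2 ^ n :=
  (card_vector n).trans (by simp)

lemma hasSum_comp_length {h : ℕ → ℝ} (hh : ∀ n, 0 ≤ h n) {a : ℝ}
    (hs : HasSum (fun n => 2 ^ n * h n) a) : HasSum (fun s : List Bool => h s.length) a := by
  rw [← (Equiv.sigmaFiberEquiv (List.length : List Bool → ℕ)).hasSum_iff]
  have h1 : ∀ n : ℕ, HasSum (fun s : {s : List Bool // s.length = n} => h s.1.length)
      (2 ^ n * h n) := by
    intro n
    have : (fun s : {s : List Bool // s.length = n} => h s.1.length) = fun _ => h n :=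
      funext fun s => by rw [s.2]
    rw [this]
    convert hasSum_fintype (fun _ : {s : List Bool // s.length = n} => h n) using 1
    simp [card_lists]
  refine HasSum.sigma_of_hasSum hs h1 ?_
  refine (summable_sigma_of_nonneg (fun _ => hh _)).2 ?_
  exact ⟨fun n => (h1 n).summable, by
    convert hs.summable using 2 with n
    exact (h1 n).tsum_eq⟩

lemma two_mul_gold_inv_sq : 2 * gold⁻¹ ^ 2 = 4 - 2 * gold := by
  rw [gold_inv]
  linarith [gold_sq]

lemma ratio_mem : 0 < 4 - 2 * gold ∧ 4 - 2 * gold < 1 := by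
  have := gold_sq
  have := gold_lt_two
  constructor <;> nlinarith [gold_pos]

lemma two_pow_mul_gold_inv_pow (n : ℕ) :
    2 ^ n * gold⁻¹ ^ (2 * n + 3) = gold⁻¹ ^ 3 * (4 - 2 * gold) ^ n := by
  rw [← two_mul_gold_inv_sq, mul_pow, ← pow_mul]
  ring

lemma gold_inv_pow_three : gold⁻¹ ^ 3 = 1 - (4 - 2 * gold) := by
  rw [gold_inv]
  linear_combination (gold - 2) * gold_sq

lemma hasSum_blockProb : HasSum blockProb 1 := by
  refine hasSum_comp_length (h := fun n => gold⁻¹ ^ (2 * n + 3))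
    (fun n => pow_nonneg (inv_nonneg.2 gold_pos.le) _) ?_
  have h := (hasSum_geometric_of_lt_one ratio_mem.1.le ratio_mem.2).mul_left (gold⁻¹ ^ 3)
  simp only [two_pow_mul_gold_inv_pow]
  rwa [show gold⁻¹ ^ 3 * (1 - (4 - 2 * gold))⁻¹ = 1 by
    rw [gold_inv_pow_three, mul_inv_cancel₀ (by linarith [ratio_mem.2])]] at h

lemma hasSum_blockProb_mul_blockLen :
    HasSum (fun s => blockProb s * blockLen s) (4 * gold + 3) := by
  have hr := ratio_mem
  have := hasSum_comp_length (h := fun n : ℕ => gold⁻¹ ^ (2 * n + 3) * (2 * n + 3 : ℕ))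
    (a := 4 * gold + 3)
    (fun n => mul_nonneg (pow_nonneg (inv_nonneg.2 gold_pos.le) _) (Nat.cast_nonneg _)) ?_
  · exact this
  have h1 := (hasSum_geometric_of_lt_one hr.1.le hr.2).mul_left (3 * gold⁻¹ ^ 3)
  have h2 := (hasSum_coe_mul_geometric_of_norm_lt_one (r := 4 - 2 * gold)
    (by rw [Real.norm_of_nonneg hr.1.le]; exact hr.2)).mul_left (2 * gold⁻¹ ^ 3)
  have hv : 2 * gold⁻¹ ^ 3 * ((4 - 2 * gold) / (1 - (4 - 2 * gold)) ^ 2) +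
      3 * gold⁻¹ ^ 3 * (1 - (4 - 2 * gold))⁻¹ = 4 * gold + 3 := by
    have hd : 1 - (4 - 2 * gold) ≠ 0 := by linarith
    have hn : 4 - 2 * gold = 2 * gold * (1 - (4 - 2 * gold)) := by linarith [gold_sq]
    rw [gold_inv_pow_three]
    generalize 1 - (4 - 2 * gold) = d at hd hn
    rw [hn]
    field_simp
    ring
  rw [← hv]
  refine (h2.add h1).congr_fun fun n => ?_
  rw [← mul_assoc, two_pow_mul_gold_inv_pow]
  push_cast
  ring

lemma blockCount_le (s : List Bool) : blockCount s ≤ 2 ^ (s.length + 1) := by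
  have : (pairVec s).1 ≤ 2 ^ s.length ∧ (pairVec s).2 ≤ 2 ^ s.length := by
    induction s with
    | nil => simp [pairVec]
    | cons b s ih =>
      rw [List.length_cons, pow_succ]
      cases b <;> simp only [pairVec] <;> omega
  rw [blockCount, pow_succ]
  omega

lemma one_le_blockCount (s : List Bool) : 1 ≤ blockCount s := by
  have := pairVec_pos s
  unfold blockCount
  omega

lemma logb_blockCount_nonneg (s : List Bool) : 0 ≤ Real.logb gold (blockCount s) :=
  Real.logb_nonneg one_lt_gold (by exact_mod_cast one_le_blockCount s)

lemma logb_blockCount_le (s : List Bool) :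
    Real.logb gold (blockCount s) ≤ Real.logb gold 2 * blockLen s := by
  have h0 : 0 ≤ Real.logb gold 2 := Real.logb_nonneg one_lt_gold one_le_two
  have h1 : Real.logb gold (blockCount s) ≤ Real.logb gold (2 ^ (s.length + 1)) := by
    refine Real.logb_le_logb_of_le one_lt_gold ?_ ?_
    · exact_mod_cast one_le_blockCount s
    · exact_mod_cast blockCount_le s
  rw [Real.logb_pow, mul_comm] at h1
  refine h1.trans (mul_le_mul_of_nonneg_left ?_ h0)
  unfold blockLen
  exact_mod_cast (by omega)

lemma summable_blockProb_mul_logb :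
    Summable fun s => blockProb s * Real.logb gold (blockCount s) := by
  refine Summable.of_nonneg_of_le
    (fun s => mul_nonneg (blockProb_nonneg s) (logb_blockCount_nonneg s)) (fun s => ?_)
    (hasSum_blockProb_mul_blockLen.summable.mul_left (Real.logb gold 2))
  have := mul_le_mul_of_nonneg_left (logb_blockCount_le s) (blockProb_nonneg s)
  linarith

lemma tsum_blockProb_mul_logb : ∑' s, blockProb s * Real.logb gold (blockCount s) =
    ∑' n : ℕ, ellcoef (n + 1) * gold⁻¹ ^ (2 * (n + 1) + 1) := by
  rw [← (Equiv.sigmaFiberEquiv (List.length : List Bool → ℕ)).tsum_eq]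
  refine (((Equiv.sigmaFiberEquiv (List.length : List Bool → ℕ)).summable_iff.2
    summable_blockProb_mul_logb).tsum_sigma).trans ?_
  refine tsum_congr fun n => ?_
  rw [ellcoef_succ, ← tsum_mul_right]
  refine tsum_congr fun s => ?_
  rw [mul_comm]
  simp only [Function.comp_apply, Equiv.sigmaFiberEquiv_apply, blockProb, blockLen, s.2]
  ring

section ReturnMap

open ProbabilityTheory
open scoped ENNReal

instance : MeasurableSpace (List Bool) := ⊤

instance : DiscreteMeasurableSpace (List Bool) := ⟨fun _ => trivial⟩

/-- The normalized Lebesgue measure on `topInterval`. -/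
noncomputable def topMeasure : Measure ℝ := cond volume topInterval

lemma measurableSet_topInterval : MeasurableSet topInterval := measurableSet_Ico

lemma volume_topInterval_ne_zero : volume topInterval ≠ 0 := by
  have := inv_lt_one_of_one_lt₀ one_lt_gold
  simp [topInterval, this]

instance : IsProbabilityMeasure topMeasure :=
  cond_isProbabilityMeasure_of_finite volume_topInterval_ne_zero (by simp [topInterval])

lemma topMeasure_apply (A : Set ℝ) :
    topMeasure A = (volume topInterval)⁻¹ * volume (topInterval ∩ A) :=
  cond_apply measurableSet_topInterval _ _

lemma topMeasure_preimage_blockMap (s : List Bool) (A : Set ℝ) :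
    topMeasure (blockMap s ⁻¹' (topInterval ∩ A)) =
      ENNReal.ofReal (blockProb s) * topMeasure A := by
  rw [topMeasure_apply, topMeasure_apply, Set.inter_eq_self_of_subset_right,
    volume_preimage_blockMap]
  · ring
  · exact fun x hx => mem_topInterval_of_blockMap_mem hx.1

/-- The points whose expansion starts with some block followed by the digit `1`. -/
def blockDomain : Set ℝ := {x | ∃ s, blockMap s x ∈ topInterval}

open Classical in
/-- The first block in the expansion of `x`. -/
noncomputable def firstBlock (x : ℝ) : List Bool :=
  if h : x ∈ blockDomain then h.choose else []

/-- The iterate of `Tgold` deleting the first block. -/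
noncomputable def returnMap (x : ℝ) : ℝ := blockMap (firstBlock x) x

lemma returnMap_mem {x : ℝ} (h : x ∈ blockDomain) : returnMap x ∈ topInterval := by
  rw [returnMap, firstBlock, dif_pos h]
  exact h.choose_spec

lemma firstBlock_eq {s : List Bool} {x : ℝ} (h : blockMap s x ∈ topInterval) :
    firstBlock x = s :=
  eq_of_blockMap_mem (returnMap_mem ⟨s, h⟩) h

lemma blockDomain_eq : blockDomain = ⋃ s, blockMap s ⁻¹' topInterval := by
  ext x
  simp [blockDomain]

lemma measurableSet_blockDomain : MeasurableSet blockDomain := by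
  rw [blockDomain_eq]
  exact .iUnion fun s => measurable_blockMap s measurableSet_topInterval

lemma measurable_firstBlock : Measurable firstBlock := by
  refine measurable_to_countable' fun s => ?_
  have : firstBlock ⁻¹' {s} = blockMap s ⁻¹' topInterval ∪
      (blockDomainᶜ ∩ {_x | s = []}) := by
    ext x
    simp only [Set.mem_preimage, Set.mem_singleton_iff, Set.mem_union, Set.mem_inter_iff,
      Set.mem_compl_iff, Set.mem_ofPred_eq]
    by_cases hx : x ∈ blockDomain
    · simp only [hx, not_true_eq_false, false_and, or_false]
      exact ⟨fun h => h ▸ returnMap_mem hx, firstBlock_eq⟩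
    · have h1 : blockMap s x ∉ topInterval := fun h => hx ⟨s, h⟩
      simp [firstBlock, hx, h1, eq_comm]
  rw [this]
  exact (measurable_blockMap s measurableSet_topInterval).union
    (measurableSet_blockDomain.compl.inter (.const _))

lemma measurable_returnMap : Measurable returnMap := by
  have : Measurable fun p : List Bool × ℝ => blockMap p.1 p.2 :=
    measurable_from_prod_countable_right measurable_blockMap
  exact this.comp (measurable_firstBlock.prodMk measurable_id)

lemma tsum_ofReal_blockProb : ∑' s, ENNReal.ofReal (blockProb s) = 1 := by
  rw [← ENNReal.ofReal_tsum_of_nonneg blockProb_nonneg hasSum_blockProb.summable,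
    hasSum_blockProb.tsum_eq, ENNReal.ofReal_one]

lemma ae_mem_blockDomain : ∀ᵐ x ∂topMeasure, x ∈ blockDomain := by
  refine (mem_ae_iff_prob_eq_one measurableSet_blockDomain).2 ?_
  rw [blockDomain_eq, measure_iUnion]
  · rw [← tsum_ofReal_blockProb]
    refine tsum_congr fun s => ?_
    simpa using topMeasure_preimage_blockMap s .univ
  · intro s s' hne
    exact Set.disjoint_left.2 fun x h h' => hne (eq_of_blockMap_mem h h')
  · exact fun s => measurable_blockMap s measurableSet_topInterval

lemma topMeasure_firstBlock_inter_returnMap (S : Set (List Bool)) {A : Set ℝ}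
    (hA : MeasurableSet A) : topMeasure (firstBlock ⁻¹' S ∩ returnMap ⁻¹' A) =
      (∑' s : S, ENNReal.ofReal (blockProb s)) * topMeasure A := by
  have h1 : firstBlock ⁻¹' S ∩ returnMap ⁻¹' A =
      ⋃ s ∈ S, firstBlock ⁻¹' {s} ∩ returnMap ⁻¹' A := by
    ext x
    simp
  rw [h1, measure_biUnion S.to_countable, ← ENNReal.tsum_mul_right]
  · refine tsum_congr fun s => ?_
    rw [← topMeasure_preimage_blockMap]
    refine measure_congr ?_
    filter_upwards [ae_mem_blockDomain] with x hx
    refine propext ⟨?_, fun h => ?_⟩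
    · rintro ⟨hs, h⟩
      change blockMap s x ∈ topInterval ∩ A
      rw [← show firstBlock x = s from hs]
      exact ⟨returnMap_mem hx, h⟩
    · have hs := firstBlock_eq h.1
      refine ⟨hs, ?_⟩
      change returnMap x ∈ A
      rw [returnMap, hs]
      exact h.2
  · intro s _ s' _ hne
    refine Disjoint.mono Set.inter_subset_left Set.inter_subset_left ?_
    exact Disjoint.preimage _ (by simpa using hne)
  · exact fun s _ => (measurable_firstBlock (.singleton s)).inter (measurable_returnMap hA)

lemma topMeasure_preimage_firstBlock (S : Set (List Bool)) :
    topMeasure (firstBlock ⁻¹' S) = ∑' s : S, ENNReal.ofReal (blockProb s) := by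
  simpa using topMeasure_firstBlock_inter_returnMap S .univ

lemma measurePreserving_returnMap : MeasurePreserving returnMap topMeasure topMeasure := by
  refine ⟨measurable_returnMap, Measure.ext fun A hA => ?_⟩
  have := topMeasure_firstBlock_inter_returnMap .univ hA
  rw [Measure.map_apply measurable_returnMap hA]
  simpa [tsum_univ (fun s => ENNReal.ofReal (blockProb s)), tsum_ofReal_blockProb] using this

lemma indepFun_firstBlock_returnMap : IndepFun firstBlock returnMap topMeasure := by
  rw [indepFun_iff_measure_inter_preimage_eq_mul]
  intro S A _ hA
  rw [topMeasure_firstBlock_inter_returnMap S hA, topMeasure_preimage_firstBlock,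
    measurePreserving_returnMap.measure_preimage hA.nullMeasurableSet]

lemma map_firstBlock : topMeasure.map firstBlock =
    Measure.sum fun s => ENNReal.ofReal (blockProb s) • Measure.dirac s := by
  refine Measure.ext_of_singleton fun s => ?_
  rw [Measure.map_apply measurable_firstBlock (.singleton s), topMeasure_preimage_firstBlock,
    Measure.sum_smul_dirac_singleton, tsum_singleton s (fun s => ENNReal.ofReal (blockProb s))]

lemma integrable_comp_firstBlock {h : List Bool → ℝ} (hh : ∀ s, 0 ≤ h s)
    (hs : Summable fun s => blockProb s * h s) :
    Integrable (fun x => h (firstBlock x)) topMeasure := by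
  have : Integrable h (topMeasure.map firstBlock) := by
    rw [map_firstBlock]
    refine integrable_sum_dirac (fun _ => ENNReal.ofReal_ne_top) ?_
    simpa [ENNReal.toReal_ofReal, blockProb_nonneg, abs_of_nonneg, hh] using hs
  exact this.comp_measurable measurable_firstBlock

lemma integral_comp_firstBlock {h : List Bool → ℝ} (hh : ∀ s, 0 ≤ h s)
    (hs : Summable fun s => blockProb s * h s) :
    ∫ x, h (firstBlock x) ∂topMeasure = ∑' s, blockProb s * h s := by
  rw [← integral_map measurable_firstBlock.aemeasurable
    (measurable_from_top (f := h)).aestronglyMeasurable, map_firstBlock,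
    integral_sum_dirac_eq_tsum (fun _ => ENNReal.ofReal_ne_top)]
  · simp [ENNReal.toReal_ofReal, blockProb_nonneg]
  · simpa [ENNReal.toReal_ofReal, blockProb_nonneg, abs_of_nonneg, hh] using hs

lemma indepFun_comp_firstBlock_iterate (h : List Bool → ℝ) {i j : ℕ} (hij : i < j) :
    IndepFun (fun x => h (firstBlock (returnMap^[i] x)))
      (fun x => h (firstBlock (returnMap^[j] x))) topMeasure := by
  obtain ⟨m, rfl⟩ := Nat.exists_eq_add_of_lt hij
  have hh : Measurable h := measurable_from_top
  have hm : Measurable fun y => h (firstBlock (returnMap^[m] y)) :=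
    hh.comp (measurable_firstBlock.comp (measurable_returnMap.iterate m))
  have h0 := indepFun_firstBlock_returnMap.comp hh hm
  rw [indepFun_iff_measure_inter_preimage_eq_mul] at h0 ⊢
  intro S A hS hA
  have h1 := h0 S A hS hA
  have hp := measurePreserving_returnMap.iterate i
  have hS' := (hh.comp measurable_firstBlock) hS
  have hA' := (hm.comp measurable_returnMap) hA
  rw [← hp.measure_preimage (hS'.inter hA').nullMeasurableSet,
    ← hp.measure_preimage hS'.nullMeasurableSet,
    ← hp.measure_preimage hA'.nullMeasurableSet] at h1
  have hj : (fun x => h (firstBlock (returnMap^[i + m + 1] x))) =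
      (fun y => h (firstBlock (returnMap^[m] y))) ∘ returnMap ∘ returnMap^[i] := by
    funext x
    rw [show i + m + 1 = m.succ + i by omega, Function.iterate_add_apply]
    rfl
  rw [hj]
  exact h1

lemma ae_tendsto_average {h : List Bool → ℝ} (hh : ∀ s, 0 ≤ h s)
    (hs : Summable fun s => blockProb s * h s) :
    ∀ᵐ x ∂topMeasure, Tendsto
      (fun k : ℕ => (∑ i ∈ Finset.range k, h (firstBlock (returnMap^[i] x))) / k) atTop
      (𝓝 (∑' s, blockProb s * h s)) := by
  have hm : Measurable fun y => h (firstBlock y) :=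
    (measurable_from_top (f := h)).comp measurable_firstBlock
  rw [← integral_comp_firstBlock hh hs]
  refine strong_law_ae_real (fun i x => h (firstBlock (returnMap^[i] x)))
    (integrable_comp_firstBlock hh hs) (fun i j hij => ?_) fun i => ?_
  · rcases lt_or_gt_of_ne hij with hlt | hlt
    · exact indepFun_comp_firstBlock_iterate h hlt
    · exact (indepFun_comp_firstBlock_iterate h hlt).symm
  · have hp := measurePreserving_returnMap.iterate i
    refine ⟨(hm.comp hp.measurable).aemeasurable, hm.aemeasurable, ?_⟩
    change Measure.map ((fun y => h (firstBlock y)) ∘ returnMap^[i]) _ = _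
    rw [← Measure.map_map hm hp.measurable, hp.map_eq]
    rfl

end ReturnMap

lemma shiftCount_iterate {x : ℝ} (hx : ∀ i, returnMap^[i] x ∈ blockDomain) (k : ℕ) :
    ∀ n, shiftCount 0 (n + ∑ i ∈ Finset.range k, blockLen (firstBlock (returnMap^[i] x))) x =
      (∏ i ∈ Finset.range k, blockCount (firstBlock (returnMap^[i] x))) *
        shiftCount 0 n (returnMap^[k] x) := by
  induction k with
  | zero => simp
  | succ k ih =>
    intro n
    rw [Finset.sum_range_succ, Finset.prod_range_succ,
      show ∀ a b, n + (a + b) = n + b + a by intros; ring, ih,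
      shiftCount_blockMap n (returnMap_mem (hx k)), Function.iterate_succ_apply', mul_assoc]
    rfl

lemma tendsto_logb_shiftCount {x : ℝ} (hx : x ∈ topInterval)
    (hd : ∀ i, returnMap^[i] x ∈ blockDomain) {m c : ℝ} (hm : m ≠ 0)
    (hL : Tendsto (fun k : ℕ =>
      (∑ i ∈ Finset.range k, (blockLen (firstBlock (returnMap^[i] x)) : ℝ)) / k) atTop (𝓝 m))
    (hG : Tendsto (fun k : ℕ =>
      (∑ i ∈ Finset.range k, Real.logb gold (blockCount (firstBlock (returnMap^[i] x)))) / k)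
      atTop (𝓝 c)) :
    Tendsto (fun n : ℕ => Real.logb gold (shiftCount 0 n x) / n) atTop (𝓝 (c / m)) := by
  have hx' := topInterval_subset hx
  refine tendsto_div_of_monotone_of_exists_subseq_tendsto_div _ _ ?_ fun a ha => ?_
  · intro n n' h
    refine Real.logb_le_logb_of_le one_lt_gold ?_ ?_
    · exact_mod_cast one_le_shiftCount hx' n
    · exact_mod_cast monotone_shiftCount hx' h
  set N : ℕ → ℕ := fun k => ∑ i ∈ Finset.range k, blockLen (firstBlock (returnMap^[i] x))
    with hN
  have hNk : ∀ k, k ≤ N k := fun k => by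
    have := Finset.card_nsmul_le_sum (Finset.range k)
      (fun i => blockLen (firstBlock (returnMap^[i] x))) 1 fun i _ => by simp [blockLen]
    simpa using this
  have hL' : Tendsto (fun k : ℕ => (N k : ℝ) / k) atTop (𝓝 m) := by
    simpa [hN] using hL
  refine ⟨N, ?_, tendsto_atTop_mono hNk tendsto_id, ?_⟩
  · have h1 : Tendsto (fun k : ℕ => ((N (k + 1) : ℝ) / (k + 1 : ℕ)) / ((N k : ℝ) / k) *
        (((k : ℝ) + 1) / k)) atTop (𝓝 (m / m * 1)) := by
      refine ((hL'.comp (tendsto_add_atTop_nat 1)).div hL' hm).mul ?_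
      have h2 := (tendsto_natCast_div_add_atTop (1 : ℝ)).inv₀ one_ne_zero
      simpa using h2
    rw [div_self hm, one_mul] at h1
    filter_upwards [h1.eventually_lt_const ha, eventually_gt_atTop 0] with k hk h0
    have hNp : (0 : ℝ) < N k := by exact_mod_cast h0.trans_le (hNk k)
    have hkp : (0 : ℝ) < k := by exact_mod_cast h0
    have h3 : ((N (k + 1) : ℝ) / (k + 1 : ℕ)) / ((N k : ℝ) / k) * (((k : ℝ) + 1) / k) =
        N (k + 1) / N k := by
      push_cast
      field_simp
    rw [h3, div_lt_iff₀ hNp] at hk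
    exact hk.le
  · refine (hG.div hL' hm).congr' ?_
    filter_upwards [eventually_gt_atTop 0] with k h0
    have h1 := shiftCount_iterate hd k 0
    rw [zero_add, shiftCount_zero_zero, mul_one] at h1
    simp only [Pi.div_apply]
    rw [div_div_div_cancel_right₀ (by exact_mod_cast h0.ne')]
    simp only [hN]
    rw [h1, Nat.cast_prod, Real.logb_prod]
    intro i _
    exact_mod_cast (Nat.pos_iff_ne_zero.1 (one_le_blockCount _))

/-- The exponent of almost every point. -/
noncomputable def typicalExponent : ℝ :=
  (∑' n : ℕ, ellcoef (n + 1) * gold⁻¹ ^ (2 * (n + 1) + 1)) / (4 * gold + 3)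

/-- The points whose exponent exists and equals the typical one. -/
def HasTypicalExponent (x : ℝ) : Prop :=
  Tendsto (fun n : ℕ => Real.logb gold (shiftCount 0 n x) / n) atTop (𝓝 typicalExponent)

lemma ae_topMeasure_hasTypicalExponent :
    ∀ᵐ x ∂topMeasure, x ∈ topInterval → HasTypicalExponent x := by
  have hd : ∀ᵐ x ∂topMeasure, ∀ i, returnMap^[i] x ∈ blockDomain := ae_all_iff.2 fun i =>
    (measurePreserving_returnMap.iterate i).quasiMeasurePreserving.ae ae_mem_blockDomain
  filter_upwards [hd, ae_tendsto_average (fun s => Nat.cast_nonneg (blockLen s))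
    hasSum_blockProb_mul_blockLen.summable,
    ae_tendsto_average logb_blockCount_nonneg summable_blockProb_mul_logb] with x h1 h2 h3 hx
  rw [hasSum_blockProb_mul_blockLen.tsum_eq] at h2
  rw [tsum_blockProb_mul_logb] at h3
  have := gold_pos
  exact tendsto_logb_shiftCount hx h1 (by positivity) h2 h3

lemma ae_hasTypicalExponent_of_mem_topInterval :
    ∀ᵐ x ∂(volume : Measure ℝ), x ∈ topInterval → HasTypicalExponent x := by
  have h := ae_topMeasure_hasTypicalExponent
  rw [topMeasure, ProbabilityTheory.cond,
    Measure.ae_ennreal_smul_measure_iff (by simp [topInterval]),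
    ae_restrict_iff' measurableSet_topInterval] at h
  filter_upwards [h] with x hx h' using hx h' h'

lemma HasTypicalExponent.of_gold_mul {x : ℝ} (h0 : 0 ≤ x) (h1 : gold * x < 1)
    (h : HasTypicalExponent (gold * x)) : HasTypicalExponent x := by
  unfold HasTypicalExponent at h ⊢
  rw [← tendsto_add_atTop_iff_nat 1]
  have h2 := h.mul (tendsto_natCast_div_add_atTop (1 : ℝ))
  rw [mul_one] at h2
  refine h2.congr' ?_
  filter_upwards [eventually_gt_atTop 0] with n hn
  have : (n : ℝ) ≠ 0 := by exact_mod_cast hn.ne'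
  rw [shiftCount_zero_of_lt n h0 h1]
  push_cast
  field_simp

lemma hasTypicalExponent_of_pow_mul (k : ℕ) : ∀ x ∈ Set.Ioo (0 : ℝ) 1,
    1 ≤ gold ^ (k + 1) * x →
    (∀ j : ℕ, gold ^ j * x ∈ topInterval → HasTypicalExponent (gold ^ j * x)) →
    HasTypicalExponent x := by
  induction k with
  | zero =>
    intro x hx h1 h
    simpa using h 0 (by simpa using mem_topInterval.2 ⟨by simpa using h1, hx.2⟩)
  | succ k ih =>
    intro x hx h1 h
    rcases lt_or_ge (gold * x) 1 with hlt | hge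
    · refine .of_gold_mul hx.1.le hlt (ih _ ⟨mul_pos gold_pos hx.1, hlt⟩ ?_ fun j hj => ?_)
      · rwa [← mul_assoc, ← pow_succ]
      · rw [← mul_assoc, ← pow_succ] at hj ⊢
        exact h _ hj
    · simpa using h 0 (by simpa using mem_topInterval.2 ⟨hge, hx.2⟩)

/-- For Lebesgue-a.e. `x ∈ (0,1)` the Fibonacci exponent of `x` exists and equals
`(Σ_{n≥1} ℓ_n λ^{−2n−1})/(4λ+3)` (indices shifted: the summand at `n : ℕ` corresponds
to the paper's `n+1`). -/
theorem lebesgue_fibonacci_exponent :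
    ∀ᵐ x ∂(volume : Measure ℝ), x ∈ Set.Ioo (0 : ℝ) 1 →
      Tendsto (fun n : ℕ => Real.logb gold (wordF (digitWord n x)) / n) atTop
        (nhds ((∑' n : ℕ, ellcoef (n + 1) * gold⁻¹ ^ (2 * (n + 1) + 1)) / (4 * gold + 3))) := by
  have h : ∀ᵐ x ∂(volume : Measure ℝ), ∀ j : ℕ,
      gold ^ j * x ∈ topInterval → HasTypicalExponent (gold ^ j * x) := by
    refine ae_all_iff.2 fun j => ?_
    have h0 := ae_iff.1 ae_hasTypicalExponent_of_mem_topInterval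
    have h1 := Real.volume_preimage_mul_left (pow_pos gold_pos j).ne'
      {y | ¬(y ∈ topInterval → HasTypicalExponent y)}
    rw [h0, mul_zero] at h1
    exact ae_iff.2 h1
  filter_upwards [h] with x hj hx
  obtain ⟨k, hk⟩ := pow_unbounded_of_one_lt x⁻¹ one_lt_gold
  have h1 : 1 ≤ gold ^ (k + 1) * x := by
    rw [← inv_le_iff_one_le_mul₀ hx.1]
    exact hk.le.trans (pow_le_pow_right₀ one_lt_gold.le k.le_succ)
  simp only [wordF_digitWord]
  exact hasTypicalExponent_of_pow_mul k x hx h1 hj
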